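/- The series ∑_{k=0}^∞ [(-1/4)_k^2 (1/4)_k (9/8)_k] / [(1/8)_k (3/2)_k^2] · (-1)^k / k! converges to 2√2/3. -/

import Mathlib

open Real Finset

noncomputable def pochR (a : ℝ) : ℕ → ℝ
  | 0 => 1
  | (n+1) => pochR a n * (a + n)

open Filter Topology

lemma pochR_pos {a : ℝ} (ha : 0 < a) (k : ℕ) : 0 < pochR a k := by
  induction k with
  | zero => simp [pochR]
  | succ k ih => simp only [pochR]; positivity

lemma pochR_le {a b : ℝ} (ha : 0 < a) (hab : a ≤ b) (k : ℕ) : pochR a k ≤ pochR b k := by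
  induction k with
  | zero => simp [pochR]
  | succ k ih =>
    have := (pochR_pos ha k).le.trans ih
    simp only [pochR]
    gcongr

lemma pochR_shift (a : ℝ) (k : ℕ) : a * pochR (a + 1) k = pochR a k * (a + k) := by
  induction k with
  | zero => simp [pochR]
  | succ k ih =>
    simp only [pochR]
    rw [← mul_assoc, ih]
    push_cast
    ring

lemma le_pochR_succ {d : ℝ} (hd : 1 ≤ d) (k : ℕ) : d ≤ pochR d (k + 1) := by
  induction k with
  | zero => simp [pochR]
  | succ k ih =>
    rw [pochR]
    have : (0 : ℝ) ≤ ((k + 1 : ℕ) : ℝ) := by positivity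
    nlinarith

/-- The summand with the linear very-well-poised factor removed. -/
noncomputable def poisedCore (a : ℝ) (k : ℕ) : ℝ :=
  pochR a k * pochR (-1/4) k ^ 2 * (-1) ^ k / (k.factorial * pochR (a + 5/4) k ^ 2)

/-- The very-well-poised summand with parameters `a`, `-1/4`, `-1/4`. -/
noncomputable def poisedTerm (a : ℝ) (k : ℕ) : ℝ :=
  poisedCore a k * ((a + 2 * k) / a)

/-- The ratio between the sums with parameters `a + 1` and `a`. -/
noncomputable def poisedRatio (a : ℝ) : ℝ := (a + 5/4) ^ 2 / ((a + 1) * (a + 3/2))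

lemma poisedCore_succ {a : ℝ} (ha : 0 < a) (k : ℕ) :
    (k + 1) * poisedCore a (k + 1) =
      -(poisedCore a k * ((a + k) * (-1/4 + k) ^ 2 / (a + 5/4 + k) ^ 2)) := by
  have h1 := pochR_pos (show 0 < a + 5/4 by linarith) k
  have h2 : 0 < a + 5/4 + k := by positivity
  have h3 : (0 : ℝ) < k.factorial := by positivity
  simp only [poisedCore, pochR, Nat.factorial_succ, pow_succ]
  push_cast
  field_simp

lemma poisedTerm_add_one {a : ℝ} (ha : 0 < a) (k : ℕ) :
    poisedTerm (a + 1) k = poisedCore a k *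
      ((a + k) * (a + 1 + 2 * k) * (a + 5/4) ^ 2 / (a * (a + 1) * (a + 5/4 + k) ^ 2)) := by
  have h1 := pochR_pos (show 0 < a + 5/4 by linarith) k
  have h2 : 0 < a + 5/4 + k := by positivity
  have h3 : (0 : ℝ) < k.factorial := by positivity
  have e1 : pochR (a + 1) k = pochR a k * (a + k) / a := by
    rw [← pochR_shift]; field_simp
  have e2 : pochR (a + 1 + 5/4) k = pochR (a + 5/4) k * (a + 5/4 + k) / (a + 5/4) := by
    rw [← pochR_shift, show a + 1 + 5/4 = a + 5/4 + 1 by ring]; field_simp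
  simp only [poisedTerm, poisedCore, e1, e2]
  field_simp

lemma poisedTerm_telescope {a : ℝ} (ha : 0 < a) (k : ℕ) :
    poisedTerm (a + 1) k - poisedRatio a * poisedTerm a k =
      poisedRatio a / a * ((k + 1 : ℕ) * poisedCore a (k + 1)) -
        poisedRatio a / a * (k * poisedCore a k) := by
  have h2 : 0 < a + 5/4 + k := by positivity
  push_cast
  rw [poisedCore_succ ha, poisedTerm_add_one ha, poisedTerm, poisedRatio]
  field_simp
  ring

lemma pochR_sq_le (k : ℕ) :
    pochR (-1/4) k ^ 2 / (k.factorial * pochR (3/2) k) ≤ 1 / ((k : ℝ) + 1) ^ 3 := by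
  induction k with
  | zero => simp [pochR]
  | succ k ih =>
    have h1 := pochR_pos (show (0 : ℝ) < 3/2 by norm_num) k
    have h3 : (0 : ℝ) < k.factorial := by positivity
    have e : pochR (-1/4) (k + 1) ^ 2 / ((k + 1).factorial * pochR (3/2) (k + 1)) =
        pochR (-1/4) k ^ 2 / (k.factorial * pochR (3/2) k) *
          ((-1/4 + k) ^ 2 / ((k + 1) * (3/2 + k))) := by
      simp only [pochR, Nat.factorial_succ]
      push_cast
      field_simp
    rw [e]
    refine (mul_le_mul_of_nonneg_right ih (by positivity)).trans ?_
    push_cast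
    have hk : (0 : ℝ) ≤ k := by positivity
    rw [div_mul_div_comm, div_le_div_iff₀ (by positivity) (by positivity)]
    have h4 : 0 ≤ (k : ℝ) ^ 2 := by positivity
    have h5 : 0 ≤ (k : ℝ) ^ 3 := by positivity
    nlinarith

lemma abs_poisedCore_le {a : ℝ} (ha : 0 < a) (k : ℕ) :
    |poisedCore a k| ≤ pochR (-1/4) k ^ 2 / (k.factorial * pochR (a + 5/4) k) := by
  have h0 := pochR_pos ha k
  have h1 := pochR_pos (show 0 < a + 5/4 by linarith) k
  have h2 := pochR_le ha (show a ≤ a + 5/4 by linarith) k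
  have h3 : (0 : ℝ) < k.factorial := by positivity
  rw [poisedCore, abs_div, abs_mul, abs_pow, abs_neg, abs_one, one_pow, mul_one,
    abs_of_nonneg (by positivity), abs_of_pos (by positivity),
    div_le_div_iff₀ (by positivity) (by positivity)]
  have : 0 ≤ pochR (-1/4) k ^ 2 * k.factorial * pochR (a + 5/4) k := by positivity
  nlinarith

lemma abs_poisedCore_le_inv {a : ℝ} (ha : 1/4 ≤ a) (k : ℕ) :
    |poisedCore a k| ≤ 1 / ((k : ℝ) + 1) ^ 3 := by
  refine (abs_poisedCore_le (by linarith) k).trans (le_trans ?_ (pochR_sq_le k))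
  have h1 := pochR_pos (show (0 : ℝ) < 3/2 by norm_num) k
  have h2 := pochR_le (show (0 : ℝ) < 3/2 by norm_num) (show 3/2 ≤ a + 5/4 by linarith) k
  gcongr

lemma poisedFactor_le {a : ℝ} (ha : 1/4 ≤ a) (k : ℕ) : (a + 2 * k) / a ≤ 8 * ((k : ℝ) + 1) := by
  have hk : (0 : ℝ) ≤ k := by positivity
  rw [div_le_iff₀ (by linarith)]
  nlinarith

lemma abs_poisedTerm {a : ℝ} (ha : 0 < a) (k : ℕ) :
    |poisedTerm a k| = |poisedCore a k| * ((a + 2 * k) / a) := by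
  rw [poisedTerm, abs_mul, abs_of_nonneg (a := (a + 2 * k) / a) (by positivity)]

lemma abs_poisedTerm_le {a : ℝ} (ha : 1/4 ≤ a) (k : ℕ) :
    |poisedTerm a k| ≤ 8 * (1 / ((k : ℝ) + 1) ^ 2) := by
  have ha' : 0 < a := by linarith
  rw [abs_poisedTerm ha']
  calc _ ≤ 1 / ((k : ℝ) + 1) ^ 3 * (8 * ((k : ℝ) + 1)) :=
        mul_le_mul (abs_poisedCore_le_inv ha k) (poisedFactor_le ha k) (by positivity)
          (by positivity)
    _ = _ := by field_simp

lemma summable_poisedBound : Summable fun k : ℕ => 8 * (1 / ((k : ℝ) + 1) ^ 2) := by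
  have := (summable_nat_add_iff 1).2 (Real.summable_one_div_nat_pow.2 (show 1 < 2 by norm_num))
  push_cast at this
  exact this.mul_left 8

lemma summable_poisedTerm {a : ℝ} (ha : 1/4 ≤ a) : Summable (poisedTerm a) :=
  Summable.of_norm_bounded summable_poisedBound (abs_poisedTerm_le ha)

lemma tendsto_mul_poisedCore {a : ℝ} (ha : 1/4 ≤ a) :
    Tendsto (fun k : ℕ => k * poisedCore a k) atTop (𝓝 0) := by
  refine squeeze_zero_norm (fun k => ?_) (tendsto_one_div_add_atTop_nhds_zero_nat (𝕜 := ℝ))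
  rw [Real.norm_eq_abs, abs_mul, Nat.abs_cast]
  have hk : (0 : ℝ) ≤ k := by positivity
  calc _ ≤ (k : ℝ) * (1 / ((k : ℝ) + 1) ^ 3) := by gcongr; exact abs_poisedCore_le_inv ha k
    _ ≤ _ := by
      rw [mul_one_div, div_le_div_iff₀ (by positivity) (by positivity)]
      nlinarith [pow_nonneg hk 2, pow_nonneg hk 3]

lemma tsum_poisedTerm_add_one {a : ℝ} (ha : 1/4 ≤ a) :
    ∑' k, poisedTerm (a + 1) k = poisedRatio a * ∑' k, poisedTerm a k := by
  have h1 := (summable_poisedTerm (show 1/4 ≤ a + 1 by linarith)).hasSum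
  have h2 := (summable_poisedTerm ha).hasSum.mul_left (poisedRatio a)
  have h3 := (h1.sub h2).tendsto_sum_nat
  have h4 := (tendsto_mul_poisedCore ha).const_mul (poisedRatio a / a)
  rw [mul_zero] at h4
  have h5 : (fun n => ∑ k ∈ range n, (poisedTerm (a + 1) k - poisedRatio a * poisedTerm a k)) =
      fun n : ℕ => poisedRatio a / a * (n * poisedCore a n) := by
    funext n
    rw [sum_congr rfl fun k _ => poisedTerm_telescope (by linarith) k,
      sum_range_sub (fun k : ℕ => poisedRatio a / a * (k * poisedCore a k))]
    simp
  rw [h5] at h3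
  exact sub_eq_zero.1 (tendsto_nhds_unique h3 h4)

lemma tsum_poisedTerm_add_nat {a : ℝ} (ha : 1/4 ≤ a) (n : ℕ) :
    ∑' k, poisedTerm (a + n) k =
      (∏ i ∈ range n, poisedRatio (a + i)) * ∑' k, poisedTerm a k := by
  induction n with
  | zero => simp
  | succ n ih =>
    have hn : (0 : ℝ) ≤ n := by positivity
    rw [prod_range_succ]
    push_cast
    rw [← add_assoc, tsum_poisedTerm_add_one (by linarith), ih]
    ring

lemma tendsto_poisedTerm_succ {a : ℝ} (ha : 1/4 ≤ a) (k : ℕ) :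
    Tendsto (fun n : ℕ => poisedTerm (a + n) (k + 1)) atTop (𝓝 0) := by
  set C : ℝ := pochR (-1/4) (k + 1) ^ 2 * (8 * (((k + 1 : ℕ) : ℝ) + 1)) with hC
  have hlim := (tendsto_one_div_add_atTop_nhds_zero_nat (𝕜 := ℝ)).const_mul C
  rw [mul_zero] at hlim
  refine squeeze_zero_norm (fun n => ?_) hlim
  have hn : (0 : ℝ) ≤ n := by positivity
  have han : 1/4 ≤ a + n := by linarith
  have hpos : 0 < a + n := by linarith
  have h1 : (n : ℝ) + 1 ≤ pochR (a + n + 5/4) (k + 1) :=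
    le_trans (by linarith) (le_pochR_succ (by linarith) k)
  have h2 : (1 : ℝ) ≤ (k + 1).factorial := by exact_mod_cast Nat.factorial_pos _
  rw [Real.norm_eq_abs, abs_poisedTerm hpos]
  calc _ ≤ pochR (-1/4) (k + 1) ^ 2 / (1 * ((n : ℝ) + 1)) * (8 * (((k + 1 : ℕ) : ℝ) + 1)) := by
        refine mul_le_mul ((abs_poisedCore_le hpos _).trans ?_) (poisedFactor_le han _)
          (by positivity) (by positivity)
        gcongr
    _ = _ := by rw [hC]; field_simp

lemma tendsto_tsum_poisedTerm {a : ℝ} (ha : 1/4 ≤ a) :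
    Tendsto (fun n : ℕ => ∑' k, poisedTerm (a + n) k) atTop (𝓝 1) := by
  have hterm : ∀ k : ℕ, Tendsto (fun n : ℕ => poisedTerm (a + n) k) atTop
      (𝓝 (if k = 0 then 1 else 0)) := by
    rintro (_ | k)
    · refine tendsto_const_nhds.congr fun n => ?_
      have hn : (0 : ℝ) ≤ n := by positivity
      have : a + n ≠ 0 := by linarith
      simp [poisedTerm, poisedCore, pochR, this]
    · simpa using tendsto_poisedTerm_succ ha k
  have := tendsto_tsum_of_dominated_convergence summable_poisedBound hterm
    (Eventually.of_forall fun n k => abs_poisedTerm_le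
      (by have : (0 : ℝ) ≤ n := by positivity
          linarith) k)
  simpa using this

lemma tendsto_prod_poisedRatio :
    Tendsto (fun n : ℕ => ∏ i ∈ range n, poisedRatio (1/4 + i)) atTop
      (𝓝 (Gamma (5/4) * Gamma (7/4) / Gamma (3/2) ^ 2)) := by
  rw [← tendsto_add_atTop_iff_nat 1]
  have hΓ : Gamma (3/2) ^ 2 ≠ 0 := (pow_pos (Gamma_pos_of_pos (by norm_num)) 2).ne'
  refine (((GammaSeq_tendsto_Gamma (5/4)).mul (GammaSeq_tendsto_Gamma (7/4))).div
    ((GammaSeq_tendsto_Gamma (3/2)).pow 2) hΓ).congr' ?_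
  filter_upwards [eventually_gt_atTop 0] with n hn
  have hn' : (0 : ℝ) < n := by exact_mod_cast hn
  have hprod : ∀ s : ℝ, 0 < s → 0 < ∏ j ∈ range (n + 1), (s + j) :=
    fun s hs => prod_pos fun j _ => by positivity
  have h1 := hprod (5/4) (by norm_num)
  have h2 := hprod (7/4) (by norm_num)
  have h3 := hprod (3/2) (by norm_num)
  have hpow : (n : ℝ) ^ (5/4 : ℝ) * (n : ℝ) ^ (7/4 : ℝ) = ((n : ℝ) ^ (3/2 : ℝ)) ^ 2 := by
    rw [← rpow_add hn', ← rpow_natCast, ← rpow_mul hn'.le]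
    norm_num
  have hratio : ∀ i : ℕ, poisedRatio (1/4 + i) =
      (3/2 + i) ^ 2 / ((5/4 + i) * (7/4 + (i : ℝ))) := by
    intro i
    rw [poisedRatio]
    ring_nf
  simp only [hratio, prod_div_distrib, prod_pow, prod_mul_distrib, Pi.div_apply,
    GammaSeq]
  have h4 : (0 : ℝ) < (n : ℝ) ^ (3/2 : ℝ) := by positivity
  have h5 : (0 : ℝ) < n.factorial := by positivity
  rw [div_mul_div_comm, mul_mul_mul_comm, hpow]
  field_simp

lemma Gamma_quotient :
    Gamma (5/4) * Gamma (7/4) / Gamma (3/2) ^ 2 = 3 * √2 / 4 := by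
  have h1 : Gamma (5/4) = 1/4 * Gamma (1/4) := by
    rw [← Gamma_add_one (by norm_num)]; norm_num
  have h2 : Gamma (7/4) = 3/4 * Gamma (3/4) := by
    rw [← Gamma_add_one (by norm_num)]; norm_num
  have h3 : Gamma (3/2) = 1/2 * √π := by
    rw [← Gamma_one_half_eq, ← Gamma_add_one (by norm_num)]; norm_num
  have h4 : Gamma (1/4) * Gamma (3/4) = π / (√2 / 2) := by
    have := Gamma_mul_Gamma_one_sub (1/4)
    rw [show (1 : ℝ) - 1/4 = 3/4 by norm_num, show π * (1/4) = π / 4 by ring,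
      sin_pi_div_four] at this
    exact this
  have h5 : √2 ^ 2 = (2 : ℝ) := sq_sqrt (by norm_num)
  have hπ := pi_pos
  rw [h1, h2, h3, mul_pow, sq_sqrt hπ.le,
    show 1/4 * Gamma (1/4) * (3/4 * Gamma (3/4)) = 3/16 * (Gamma (1/4) * Gamma (3/4)) by ring, h4]
  field_simp
  rw [h5]
  norm_num

lemma tsum_poisedTerm_quarter : ∑' k, poisedTerm (1/4) k = 2 * √2 / 3 := by
  have h := tendsto_tsum_poisedTerm (le_refl (1/4 : ℝ))
  simp only [tsum_poisedTerm_add_nat (le_refl (1/4 : ℝ))] at h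
  have h' := tendsto_nhds_unique h (tendsto_prod_poisedRatio.mul_const _)
  rw [Gamma_quotient] at h'
  have h5 : √2 * √2 = (2 : ℝ) := mul_self_sqrt (by norm_num)
  linear_combination (-(2 * √2 / 3)) * h' - (∑' k, poisedTerm (1/4) k) / 2 * h5

theorem stmt15 :
    HasSum (fun k : ℕ =>
      (pochR (-1/4) k ^ 2 * pochR (1/4) k * pochR (9/8) k) /
        (pochR (1/8) k * pochR (3/2) k ^ 2) * (-1) ^ k / (Nat.factorial k : ℝ))
      (2 * Real.sqrt 2 / 3) := by
  have h := (summable_poisedTerm (le_refl (1/4 : ℝ))).hasSum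
  rw [tsum_poisedTerm_quarter] at h
  convert h using 2 with k
  have h1 := pochR_pos (show (0 : ℝ) < 1/8 by norm_num) k
  have h2 := pochR_pos (show (0 : ℝ) < 3/2 by norm_num) k
  have h3 : (0 : ℝ) < k.factorial := by positivity
  have e : pochR (9/8) k = pochR (1/8) k * (1/8 + k) / (1/8) := by
    rw [← pochR_shift]; norm_num
  rw [poisedTerm, poisedCore, e, show (1/4 : ℝ) + 5/4 = 3/2 by norm_num]
  field_simp
  ring
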